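/- arXiv:1601.06928 — 3 statements merged into one kernel-verified Lean document; each statement's English description precedes it below -/
import Mathlib

section
/- Let A = ⊕_{i=0}^c A_i be a graded Artinian Gorenstein algebra over a field K = A_0 (i.e., the socle 0 :_A m is one-dimensional over K, where m = ⊕_{i≥1} A_i). Assume the Hilbert function of A is unimodal and that A has the matching property. Then A has the Sperner property: the maximum of μ(I) over all ideals I of A equals max_i dim_K A_i. -/
open Module

/-- `μ(I) = dim_K I/mI`, the minimal number of generators of an ideal `I` of a graded algebra
`A` over `K` with graded maximal ideal `m`. -/
noncomputable def nu (K : Type*) {A : Type*} [Field K] [CommRing A] [Algebra K A]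
    (m I : Ideal A) : ℕ :=
  finrank K
    (↥(I.restrictScalars K) ⧸
      (Submodule.comap (I.restrictScalars K).subtype ((m * I).restrictScalars K)))

/-- For subspaces `W, V` of a `K`-algebra `A`, the `K`-span of `{x * v : x ∈ W, v ∈ V}`. -/
noncomputable def mulSpan {K A : Type*} [Field K] [CommRing A] [Algebra K A]
    (W V : Submodule K A) : Submodule K A :=
  Submodule.span K {z | ∃ x ∈ W, ∃ v ∈ V, z = x * v}

section Sperner

variable {K A : Type*} [Field K] [CommRing A] [Algebra K A]

theorem nu_add_finrank_mul [FiniteDimensional K A] (m I : Ideal A) :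
    nu K m I + finrank K ((m * I).restrictScalars K) = finrank K (I.restrictScalars K) := by
  have hle : (m * I).restrictScalars K ≤ I.restrictScalars K :=
    show m * I ≤ I from Ideal.mul_le_right
  rw [← (Submodule.comapSubtypeEquivOfLe hle).finrank_eq]
  exact Submodule.finrank_quotient_add_finrank _

theorem mul_mem_mulSpan {W V : Submodule K A} {x v : A} (hx : x ∈ W) (hv : v ∈ V) :
    x * v ∈ mulSpan W V :=
  Submodule.subset_span ⟨x, hx, v, hv, rfl⟩

theorem mulSpan_le {W V U : Submodule K A} :
    mulSpan W V ≤ U ↔ ∀ x ∈ W, ∀ v ∈ V, x * v ∈ U := by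
  rw [mulSpan, Submodule.span_le]
  constructor
  · exact fun h x hx v hv => h ⟨x, hx, v, hv, rfl⟩
  · rintro h _ ⟨x, hx, v, hv, rfl⟩
    exact h x hx v hv

/-- The elements of `U` annihilated by `Z` under the form `(u, z) ↦ φ (u * z)` have codimension
at most `dim Z` in `U`. -/
theorem exists_annihilated_subspace [FiniteDimensional K A] (φ : Dual K A)
    (U Z : Submodule K A) :
    ∃ W ≤ U, (∀ w ∈ W, ∀ z ∈ Z, φ (w * z) = 0) ∧
      finrank K U ≤ finrank K W + finrank K Z := by
  let f : U →ₗ[K] Dual K Z :=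
    ((LinearMap.mul K A).compr₂ φ).compl₁₂ U.subtype Z.subtype
  refine ⟨f.ker.map U.subtype, Submodule.map_subtype_le _ _, ?_, ?_⟩
  · rintro _ ⟨w, hw, rfl⟩ z hz
    exact LinearMap.congr_fun (LinearMap.mem_ker.mp hw) ⟨z, hz⟩
  · rw [Submodule.finrank_map_subtype_eq, ← f.finrank_range_add_finrank_ker, add_comm,
      ← Subspace.dual_finrank_eq (K := K) (V := Z)]
    exact Nat.add_le_add_left (Submodule.finrank_le _) _

/-- If `X` pairs to zero with `V ≤ U`, but no nonzero element of `X` pairs to zero with `U`, then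
`dim X` is at most the codimension of `V` in `U`. -/
theorem finrank_add_finrank_le_of_pairing_eq_zero [FiniteDimensional K A] (φ : Dual K A)
    {X V U : Submodule K A} (hVU : V ≤ U)
    (hnondeg : ∀ x ∈ X, (∀ u ∈ U, φ (x * u) = 0) → x = 0)
    (hzero : ∀ x ∈ X, ∀ v ∈ V, φ (x * v) = 0) :
    finrank K X + finrank K V ≤ finrank K U := by
  let f : X →ₗ[K] Dual K U :=
    ((LinearMap.mul K A).compr₂ φ).compl₁₂ X.subtype U.subtype
  have hf : Function.Injective f := by
    rw [injective_iff_map_eq_zero]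
    intro x hx
    exact Subtype.ext (hnondeg x x.2 fun u hu => LinearMap.congr_fun hx ⟨u, hu⟩)
  let V' : Submodule K U := V.comap U.subtype
  have hmem : ∀ x, f x ∈ V'.dualAnnihilator := by
    intro x
    rw [Submodule.mem_dualAnnihilator]
    exact fun v hv => hzero x x.2 v hv
  have hcod : Function.Injective (f.codRestrict _ hmem) := fun x y h =>
    hf (congrArg Subtype.val h)
  have hle := LinearMap.finrank_le_finrank_of_injective hcod
  have hV' : finrank K V' = finrank K V := (Submodule.comapSubtypeEquivOfLe hVU).finrank_eq
  have hsum := Subspace.finrank_add_finrank_dualAnnihilator_eq V'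
  omega

variable (𝒜 : ℕ → Submodule K A) [GradedAlgebra 𝒜]

open DirectSum in
theorem proj_of_mem_of_ne {i j : ℕ} {a : A} (ha : a ∈ 𝒜 i) (hij : i ≠ j) :
    GradedAlgebra.proj 𝒜 j a = 0 :=
  decompose_of_mem_ne 𝒜 ha hij

open DirectSum in
theorem proj_of_mem {i : ℕ} {a : A} (ha : a ∈ 𝒜 i) : GradedAlgebra.proj 𝒜 i a = a :=
  decompose_of_mem_same 𝒜 ha

theorem proj_mem (i : ℕ) (a : A) : GradedAlgebra.proj 𝒜 i a ∈ 𝒜 i :=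
  SetLike.coe_mem _

theorem eq_zero_of_forall_proj_eq_zero {a : A} (h : ∀ i, GradedAlgebra.proj 𝒜 i a = 0) :
    a = 0 := by
  classical
  rw [← DirectSum.sum_support_decompose 𝒜 a]
  exact Finset.sum_eq_zero fun i _ => h i

/-- The subspace `⊕_{i ≥ n} A_i`. -/
def degreeGE (n : ℕ) : Submodule K A where
  carrier := {a | ∀ i < n, GradedAlgebra.proj 𝒜 i a = 0}
  add_mem' ha hb i hi := by rw [map_add, ha i hi, hb i hi, add_zero]
  zero_mem' _ _ := map_zero _
  smul_mem' k a ha i hi := by rw [map_smul, ha i hi, smul_zero]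

theorem mem_degreeGE {n : ℕ} {a : A} :
    a ∈ degreeGE 𝒜 n ↔ ∀ i < n, GradedAlgebra.proj 𝒜 i a = 0 := Iff.rfl

theorem le_degreeGE (n : ℕ) : 𝒜 n ≤ degreeGE 𝒜 n := fun _ ha _ hi =>
  proj_of_mem_of_ne 𝒜 ha hi.ne'

theorem degreeGE_zero : degreeGE 𝒜 0 = ⊤ :=
  eq_top_iff.mpr fun _ _ i hi => absurd hi (Nat.not_lt_zero i)

theorem degreeGE_eq_bot {n : ℕ} (h : ∀ i, n ≤ i → 𝒜 i = ⊥) : degreeGE 𝒜 n = ⊥ := by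
  rw [eq_bot_iff]
  intro a ha
  refine eq_zero_of_forall_proj_eq_zero 𝒜 fun i => ?_
  rcases lt_or_ge i n with hi | hi
  · exact ha i hi
  · simpa [h i hi] using proj_mem 𝒜 i a

theorem proj_mul_of_mem {i n : ℕ} {a : A} (ha : a ∈ 𝒜 i) (b : A) :
    GradedAlgebra.proj 𝒜 n (a * b) =
      if i ≤ n then a * GradedAlgebra.proj 𝒜 (n - i) b else 0 :=
  DirectSum.coe_decompose_mul_of_left_mem 𝒜 n ha

theorem mul_mem_degreeGE {k n : ℕ} {a b : A} (ha : a ∈ degreeGE 𝒜 k)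
    (hb : b ∈ degreeGE 𝒜 n) : a * b ∈ degreeGE 𝒜 (k + n) := by
  classical
  rw [← DirectSum.sum_support_decompose 𝒜 a, Finset.sum_mul]
  refine Submodule.sum_mem _ fun i _ d hd => ?_
  rw [proj_mul_of_mem 𝒜 (SetLike.coe_mem _)]
  split_ifs with hid
  · rcases lt_or_ge i k with hik | hik
    · rw [← GradedAlgebra.proj_apply, ha i hik, zero_mul]
    · rw [hb (d - i) (by omega), mul_zero]
  · rfl

theorem irrelevant_eq_degreeGE :
    (HomogeneousIdeal.irrelevant 𝒜).toIdeal.restrictScalars K = degreeGE 𝒜 1 := by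
  ext a
  rw [Submodule.restrictScalars_mem, HomogeneousIdeal.mem_iff,
    HomogeneousIdeal.mem_irrelevant_iff, mem_degreeGE]
  simp [GradedAlgebra.proj_apply, GradedRing.proj_apply]

theorem mem_irrelevant_of_mem {i : ℕ} (hi : 0 < i) {a : A} (ha : a ∈ 𝒜 i) :
    a ∈ (HomogeneousIdeal.irrelevant 𝒜).toIdeal :=
  HomogeneousIdeal.mem_irrelevant_of_mem 𝒜 hi ha

/-- The ideal `⊕_{i ≥ n} A_i`. -/
def degreeGEIdeal (n : ℕ) : Ideal A where
  __ := degreeGE 𝒜 n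
  smul_mem' a b hb := by
    have := mul_mem_degreeGE 𝒜 (k := 0) (a := a) (by rw [degreeGE_zero]; trivial) hb
    rwa [zero_add] at this

/-- The degree `n` part of the space of lowest degree forms of the elements of `U`. -/
def initialPart (U : Submodule K A) (n : ℕ) : Submodule K A :=
  (U ⊓ degreeGE 𝒜 n).map (GradedAlgebra.proj 𝒜 n)

theorem initialPart_le (U : Submodule K A) (n : ℕ) : initialPart 𝒜 U n ≤ 𝒜 n := by
  rintro _ ⟨a, -, rfl⟩
  exact proj_mem 𝒜 n a

theorem initialPart_top (n : ℕ) : initialPart 𝒜 ⊤ n = 𝒜 n :=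
  (initialPart_le 𝒜 ⊤ n).antisymm fun a ha =>
    ⟨a, ⟨trivial, le_degreeGE 𝒜 n ha⟩, proj_of_mem 𝒜 ha⟩

theorem finrank_inf_degreeGE [FiniteDimensional K A] (U : Submodule K A) (n : ℕ) :
    finrank K ↥(U ⊓ degreeGE 𝒜 n) =
      finrank K (initialPart 𝒜 U n) + finrank K ↥(U ⊓ degreeGE 𝒜 (n + 1)) := by
  let f := (GradedAlgebra.proj 𝒜 n).domRestrict (U ⊓ degreeGE 𝒜 n)
  have hrange : f.range = initialPart 𝒜 U n := LinearMap.range_domRestrict _ _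
  have hker : f.ker.map (U ⊓ degreeGE 𝒜 n).subtype = U ⊓ degreeGE 𝒜 (n + 1) := by
    ext a
    constructor
    · rintro ⟨⟨a, haU, han⟩, ha, rfl⟩
      refine ⟨haU, fun i hi => ?_⟩
      rcases Nat.lt_succ_iff_lt_or_eq.mp hi with hi | rfl
      · exact han i hi
      · exact ha
    · rintro ⟨haU, han⟩
      exact ⟨⟨a, haU, fun i hi => han i (by omega)⟩, han n (by omega), rfl⟩
  rw [← f.finrank_range_add_finrank_ker, hrange, ← hker, Submodule.finrank_map_subtype_eq]

theorem finrank_eq_sum_initialPart [FiniteDimensional K A] (U : Submodule K A) {n : ℕ}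
    (h : ∀ i, n ≤ i → 𝒜 i = ⊥) :
    finrank K U = ∑ i ∈ Finset.range n, finrank K (initialPart 𝒜 U i) := by
  have hsum : ∀ k, finrank K U =
      ∑ i ∈ Finset.range k, finrank K (initialPart 𝒜 U i) +
        finrank K ↥(U ⊓ degreeGE 𝒜 k) := by
    intro k
    induction k with
    | zero => rw [degreeGE_zero, inf_top_eq, Finset.sum_range_zero, zero_add]
    | succ k ih => rw [ih, finrank_inf_degreeGE, Finset.sum_range_succ, add_assoc]
  have hn := hsum n
  rwa [degreeGE_eq_bot 𝒜 h, inf_bot_eq, finrank_bot, add_zero] at hn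

theorem mulSpan_initialPart_le (I : Ideal A) (n : ℕ) :
    mulSpan (𝒜 1) (initialPart 𝒜 (I.restrictScalars K) n) ≤
      initialPart 𝒜
        (((HomogeneousIdeal.irrelevant 𝒜).toIdeal * I).restrictScalars K) (n + 1) := by
  rw [mulSpan_le]
  rintro x hx _ ⟨a, ⟨haI, han⟩, rfl⟩
  refine ⟨x * a, ⟨Ideal.mul_mem_mul (mem_irrelevant_of_mem 𝒜 one_pos hx) haI, ?_⟩, ?_⟩
  · rw [add_comm]
    exact mul_mem_degreeGE 𝒜 (le_degreeGE 𝒜 1 hx) han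
  · rw [proj_mul_of_mem 𝒜 hx, if_pos (Nat.le_add_left 1 n), Nat.add_sub_cancel]

theorem finrank_le_nu_degreeGEIdeal [FiniteDimensional K A] (n : ℕ) :
    finrank K (𝒜 n) ≤ nu K (HomogeneousIdeal.irrelevant 𝒜).toIdeal (degreeGEIdeal 𝒜 n) := by
  have hnu := nu_add_finrank_mul (K := K) (HomogeneousIdeal.irrelevant 𝒜).toIdeal
    (degreeGEIdeal 𝒜 n)
  have hmul : ((HomogeneousIdeal.irrelevant 𝒜).toIdeal * degreeGEIdeal 𝒜 n).restrictScalars K ≤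
      degreeGE 𝒜 (n + 1) := by
    intro a ha
    refine Submodule.mul_induction_on (C := fun a => a ∈ degreeGE 𝒜 (n + 1))
      ((Submodule.restrictScalars_mem K _ a).mp ha) ?_ fun a b => Submodule.add_mem _
    intro x hx y hy
    rw [add_comm]
    refine mul_mem_degreeGE 𝒜 ?_ hy
    rw [← irrelevant_eq_degreeGE]
    exact hx
  have hrank := finrank_inf_degreeGE 𝒜 ⊤ n
  rw [top_inf_eq, top_inf_eq, initialPart_top] at hrank
  have hself : (degreeGEIdeal 𝒜 n).restrictScalars K = degreeGE 𝒜 n := rfl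
  rw [hself] at hnu
  have := Submodule.finrank_mono hmul
  omega

/-- A graded algebra with one-dimensional socle has a functional `φ` such that, for some `s`,
`(a, b) ↦ φ (a * b)` is a perfect pairing `A_j × A_{s-j} → K` for every `j ≤ s`, while `A_j = 0`
for `j > s`. -/
theorem exists_dual_pairing (c : ℕ) (htop : ∀ i, c < i → 𝒜 i = ⊥)
    (hGor : finrank K
      (((⊥ : Ideal A).colon (HomogeneousIdeal.irrelevant 𝒜).toIdeal).restrictScalars K) = 1) :
    ∃ (φ : Dual K A) (s : ℕ), (∀ i, s < i → 𝒜 i = ⊥) ∧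
      ∀ k j, j + k = s → ∀ a ∈ 𝒜 j, (∀ b ∈ 𝒜 k, φ (a * b) = 0) → a = 0 := by
  classical
  obtain ⟨⟨e, he⟩, he0, hspan⟩ := finrank_eq_one_iff'.mp hGor
  have he0 : e ≠ 0 := fun h => he0 (Subtype.ext h)
  have hex : ∃ i, 𝒜 i ≠ ⊥ := by
    by_contra! h
    exact he0 (eq_zero_of_forall_proj_eq_zero 𝒜 fun i => by simpa [h i] using proj_mem 𝒜 i e)
  obtain ⟨s, hs, hmax⟩ : ∃ s, 𝒜 s ≠ ⊥ ∧ ∀ i, s < i → 𝒜 i = ⊥ := by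
    obtain ⟨i, hi⟩ := hex
    have hic : i ≤ c := not_lt.mp fun h => hi (htop i h)
    refine ⟨Nat.findGreatest (fun i => 𝒜 i ≠ ⊥) c,
      Nat.findGreatest_spec (P := fun i => 𝒜 i ≠ ⊥) hic hi, fun k hk => ?_⟩
    rcases le_or_gt k c with hkc | hkc
    · exact not_not.mp (Nat.findGreatest_is_greatest hk hkc)
    · exact htop k hkc
  have hsocle : ∀ a, (∀ x ∈ degreeGE 𝒜 1, a * x = 0) → ∃ k : K, k • e = a := by
    intro a ha
    obtain ⟨k, hk⟩ := hspan ⟨a, Submodule.mem_colon.mpr fun x hx => ha x (by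
      rw [← irrelevant_eq_degreeGE]; exact hx)⟩
    exact ⟨k, congrArg Subtype.val hk⟩
  have hbot : degreeGE 𝒜 (s + 1) = ⊥ := degreeGE_eq_bot 𝒜 hmax
  have htop_socle : ∀ a ∈ 𝒜 s, ∃ k : K, k • e = a := fun a ha => hsocle a fun x hx => by
    have := mul_mem_degreeGE 𝒜 (le_degreeGE 𝒜 s ha) hx
    rwa [hbot] at this
  have hes : e ∈ 𝒜 s := by
    obtain ⟨t, ht, ht0⟩ := Submodule.exists_mem_ne_zero_of_ne_bot hs
    obtain ⟨k, rfl⟩ := htop_socle t ht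
    have hk : k ≠ 0 := fun h => ht0 (by rw [h, zero_smul])
    exact ((𝒜 s).smul_mem_iff hk).mp ht
  obtain ⟨φ, hφ⟩ : ∃ φ : Dual K A, φ e ≠ 0 := by
    by_contra! h
    exact he0 ((forall_dual_apply_eq_zero_iff K e).mp h)
  refine ⟨φ, s, hmax, fun k => ?_⟩
  induction k using Nat.strong_induction_on with
  | _ k ih =>
  intro j hjk a ha h
  have hsoc : ∀ x ∈ degreeGE 𝒜 1, a * x = 0 := by
    intro x hx
    refine eq_zero_of_forall_proj_eq_zero 𝒜 fun d => ?_
    rw [proj_mul_of_mem 𝒜 ha]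
    split_ifs with hjd
    · obtain ⟨i, rfl⟩ := Nat.exists_eq_add_of_le hjd
      rw [Nat.add_sub_cancel_left]
      have hay := SetLike.mul_mem_graded ha (proj_mem 𝒜 i x)
      rcases Nat.eq_zero_or_pos i with rfl | hi
      · rw [hx 0 one_pos, mul_zero]
      · rcases le_or_gt i k with hik | hik
        · refine ih (k - i) (by omega) (j + i) (by omega) _ hay fun b hb => ?_
          rw [mul_assoc]
          refine h _ ?_
          have := SetLike.mul_mem_graded (proj_mem 𝒜 i x) hb
          rwa [Nat.add_sub_cancel' hik] at this
        · rwa [hmax (j + i) (by omega), Submodule.mem_bot] at hay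
    · rfl
  obtain ⟨t, rfl⟩ := hsocle a hsoc
  rcases Nat.eq_zero_or_pos k with rfl | hk
  · have h1 := h 1 SetLike.GradedOne.one_mem
    rw [mul_one, map_smul, smul_eq_mul] at h1
    rw [(mul_eq_zero.mp h1).resolve_right hφ, zero_smul]
  · rw [← proj_of_mem 𝒜 ha]
    exact proj_of_mem_of_ne 𝒜 ((𝒜 s).smul_mem t hes) (by omega)

/-- By duality, the matching property in degrees where the Hilbert function increases bounds the
loss of dimension under multiplication by `A_1` in degrees where it decreases. -/
theorem finrank_add_finrank_le_mulSpan [FiniteDimensional K A] (c : ℕ)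
    (htop : ∀ i, c < i → 𝒜 i = ⊥)
    (hGor : finrank K
      (((⊥ : Ideal A).colon (HomogeneousIdeal.irrelevant 𝒜).toIdeal).restrictScalars K) = 1)
    (hmatching : ∀ j : ℕ, finrank K (𝒜 j) ≤ finrank K (𝒜 (j + 1)) →
      ∀ V : Submodule K A, V ≤ 𝒜 j → finrank K V ≤ finrank K (mulSpan (𝒜 1) V))
    {j : ℕ} (hj : finrank K (𝒜 (j + 1)) ≤ finrank K (𝒜 j)) {V : Submodule K A}
    (hV : V ≤ 𝒜 j) :
    finrank K V + finrank K (𝒜 (j + 1)) ≤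
      finrank K (mulSpan (𝒜 1) V) + finrank K (𝒜 j) := by
  obtain ⟨φ, s, hmax, hnondeg⟩ := exists_dual_pairing 𝒜 c htop hGor
  rcases le_or_gt s j with hsj | hsj
  · rw [hmax (j + 1) (by omega), finrank_bot]
    have := Submodule.finrank_mono hV
    omega
  obtain ⟨d, rfl⟩ := Nat.exists_eq_add_of_lt hsj
  have hle : ∀ i k, i + k = j + d + 1 → finrank K (𝒜 i) ≤ finrank K (𝒜 k) := by
    intro i k hik
    have := finrank_add_finrank_le_of_pairing_eq_zero φ (X := 𝒜 i) (V := ⊥) (U := 𝒜 k) bot_le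
      (hnondeg k i hik) (by
        rintro x - v hv
        rw [(Submodule.mem_bot K).mp hv, mul_zero, map_zero])
    rwa [finrank_bot, add_zero] at this
  obtain ⟨W, hWle, hW, hWrank⟩ := exists_annihilated_subspace φ (𝒜 d) (mulSpan (𝒜 1) V)
  have hmul : mulSpan (𝒜 1) W ≤ 𝒜 (d + 1) := by
    rw [mulSpan_le]
    intro x hx w hw
    rw [add_comm]
    exact SetLike.mul_mem_graded hx (hWle hw)
  have hann : ∀ x ∈ mulSpan (𝒜 1) W, ∀ v ∈ V, φ (x * v) = 0 := by
    intro x hx v hv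
    have hsub : mulSpan (𝒜 1) W ≤ (φ ∘ₗ LinearMap.mulRight K v).ker := by
      rw [mulSpan_le]
      intro y hy w hw
      rw [LinearMap.mem_ker, LinearMap.comp_apply, LinearMap.mulRight_apply, mul_comm y w,
        mul_assoc]
      exact hW w hw _ (mul_mem_mulSpan hy hv)
    exact hsub hx
  have hperp := finrank_add_finrank_le_of_pairing_eq_zero φ hV
    (fun x hx => hnondeg j (d + 1) (by omega) x (hmul hx)) hann
  have h1 := hle d (j + 1) (by omega)
  have h2 := hle (j + 1) d (by omega)
  have h3 := hle j (d + 1) (by omega)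
  have := hmatching d (by omega) W hWle
  omega

theorem nu_le_finrank_of_unimodal [FiniteDimensional K A] (c : ℕ)
    (htop : ∀ i, c < i → 𝒜 i = ⊥)
    (hGor : finrank K
      (((⊥ : Ideal A).colon (HomogeneousIdeal.irrelevant 𝒜).toIdeal).restrictScalars K) = 1)
    {p : ℕ} (hinc : ∀ j < p, finrank K (𝒜 j) ≤ finrank K (𝒜 (j + 1)))
    (hdec : ∀ j ≥ p, finrank K (𝒜 (j + 1)) ≤ finrank K (𝒜 j))
    (hmatching : ∀ j : ℕ, finrank K (𝒜 j) ≤ finrank K (𝒜 (j + 1)) →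
      ∀ V : Submodule K A, V ≤ 𝒜 j → finrank K V ≤ finrank K (mulSpan (𝒜 1) V))
    (I : Ideal A) :
    nu K (HomogeneousIdeal.irrelevant 𝒜).toIdeal I ≤ finrank K (𝒜 p) := by
  let m := (HomogeneousIdeal.irrelevant 𝒜).toIdeal
  let v : ℕ → ℕ := fun j => finrank K (initialPart 𝒜 (I.restrictScalars K) j)
  let w : ℕ → ℕ := fun j => finrank K (initialPart 𝒜 ((m * I).restrictScalars K) j)
  have hvw : ∀ j, finrank K (mulSpan (𝒜 1) (initialPart 𝒜 (I.restrictScalars K) j)) ≤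
      w (j + 1) := fun j => Submodule.finrank_mono (mulSpan_initialPart_le 𝒜 I j)
  have hlow : ∀ j < p, v j ≤ w (j + 1) := fun j hj =>
    (hmatching j (hinc j hj) _ (initialPart_le 𝒜 _ j)).trans (hvw j)
  have hhigh : ∀ j ≥ p, v j + finrank K (𝒜 (j + 1)) ≤ w (j + 1) + finrank K (𝒜 j) :=
    fun j hj => (finrank_add_finrank_le_mulSpan 𝒜 c htop hGor hmatching (hdec j hj)
      (initialPart_le 𝒜 _ j)).trans (Nat.add_le_add_right (hvw j) _)
  have hsum : ∀ n, ∑ j ∈ Finset.range (p + n), v j + finrank K (𝒜 (p + n)) ≤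
      ∑ j ∈ Finset.range (p + n), w (j + 1) + finrank K (𝒜 p) := by
    intro n
    induction n with
    | zero =>
      exact Nat.add_le_add_right
        (Finset.sum_le_sum fun j hj => hlow j (Finset.mem_range.mp hj)) _
    | succ n ih =>
      rw [← add_assoc, Finset.sum_range_succ, Finset.sum_range_succ]
      have := hhigh (p + n) (Nat.le_add_right p n)
      omega
  have hI : finrank K (I.restrictScalars K) = ∑ j ∈ Finset.range (p + (c + 1)), v j :=
    finrank_eq_sum_initialPart 𝒜 _ fun i hi => htop i (by omega)
  have hmI : finrank K ((m * I).restrictScalars K) =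
      ∑ j ∈ Finset.range (p + (c + 1) + 1), w j :=
    finrank_eq_sum_initialPart 𝒜 _ fun i hi => htop i (by omega)
  rw [Finset.sum_range_succ'] at hmI
  have hnu : nu K m I + finrank K ((m * I).restrictScalars K) = finrank K (I.restrictScalars K) :=
    nu_add_finrank_mul m I
  have := hsum (c + 1)
  change nu K m I ≤ _
  omega

end Sperner

/-- **Matching implies Sperner for Artinian Gorenstein graded algebras.**
Let `A = ⊕_{i=0}^c A_i` be a graded Artinian Gorenstein algebra over a field `K = A_0`
(so `dim_K (0 :_A m) = 1` for the graded maximal ideal `m = ⊕_{i≥1} A_i`), with unimodal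
Hilbert function.  If `A` has the matching property — `dim_K V ≤ dim_K (A_1·V)` for every
subspace `V ⊆ A_j` whenever `dim_K A_j ≤ dim_K A_{j+1}` — then `A` has the Sperner
property: the maximum of `μ(I)` over all ideals `I ⊆ A` is `max_i dim_K A_i`. -/
theorem matching_implies_sperner {K A : Type*} [Field K] [CommRing A] [Algebra K A]
    (𝒜 : ℕ → Submodule K A) [GradedAlgebra 𝒜]
    (c : ℕ) (htop : ∀ i, c < i → 𝒜 i = ⊥) [FiniteDimensional K A]
    (hA0 : 𝒜 0 = (1 : Submodule K A))
    (hGor : finrank K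
      (((⊥ : Ideal A).colon (HomogeneousIdeal.irrelevant 𝒜).toIdeal).restrictScalars K) = 1)
    (hunimodal : ∃ p : ℕ,
      (∀ i j, i ≤ j → j ≤ p → finrank K (𝒜 i) ≤ finrank K (𝒜 j)) ∧
      (∀ i j, p ≤ i → i ≤ j → finrank K (𝒜 j) ≤ finrank K (𝒜 i)))
    (hmatching : ∀ j : ℕ, finrank K (𝒜 j) ≤ finrank K (𝒜 (j + 1)) →
      ∀ V : Submodule K A, V ≤ 𝒜 j → finrank K V ≤ finrank K (mulSpan (𝒜 1) V)) :
    ∃ i₀ : ℕ, (∀ i : ℕ, finrank K (𝒜 i) ≤ finrank K (𝒜 i₀)) ∧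
      IsGreatest
        {d : ℕ | ∃ I : Ideal A, nu K (HomogeneousIdeal.irrelevant 𝒜).toIdeal I = d}
        (finrank K (𝒜 i₀)) := by
  obtain ⟨p, hinc, hdec⟩ := hunimodal
  have hupper := nu_le_finrank_of_unimodal 𝒜 c htop hGor
    (fun j hj => hinc j (j + 1) j.le_succ hj) (fun j hj => hdec j (j + 1) hj j.le_succ) hmatching
  refine ⟨p, fun i => ?_, ⟨degreeGEIdeal 𝒜 p, ?_⟩, ?_⟩
  · rcases le_total i p with hi | hi
    · exact hinc i p hi le_rfl
    · exact hdec p i le_rfl hi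
  · exact (hupper _).antisymm (finrank_le_nu_degreeGEIdeal 𝒜 p)
  · rintro _ ⟨I, rfl⟩
    exact hupper I
end

section
/- Let (A, m) be an Artinian Gorenstein local ring with Dilworth number d(A). If a and b are ideals of A with τ(a) = τ(b) = d(A), then τ(a + b) = d(A) and τ(a ∩ b) = d(A); that is, the family G(A) = {a : τ(a) = d(A)} is a lattice under sum and intersection. -/
open scoped Classical in
/-- `dim_{A/m} (a/b)`: the dimension over the residue field `A/m` of the subquotient `a/b`
(realized as the image of the ideal `a` in `A/b`), for ideals `b ⊆ a` with `m·a ⊆ b`; junk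
value `0` if `a/b` is not killed by `m`. -/
noncomputable def resQuotDim {A : Type*} [CommRing A] (m a b : Ideal A) : ℕ :=
  if h : Module.IsTorsionBySet A
      ↥(Submodule.restrictScalars A (a.map (Ideal.Quotient.mk b))) (m : Set A) then
    letI := h.module
    Module.finrank (A ⧸ m) ↥(Submodule.restrictScalars A (a.map (Ideal.Quotient.mk b)))
  else 0

/-- `μ(a) = dim_{A/m} a/ma`, the minimal number of generators of the ideal `a`. -/
noncomputable def muL {A : Type*} [CommRing A] (m a : Ideal A) : ℕ :=
  resQuotDim m a (m * a)

/-- `τ(a) = dim_{A/m} (a :_A m)/a`, the type of the ideal `a`. -/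
noncomputable def tauL {A : Type*} [CommRing A] (m a : Ideal A) : ℕ :=
  resQuotDim m (a.colon m) a

namespace Submodule

variable {R M : Type*} [Ring R] [AddCommGroup M] [Module R M]

lemma length_add_length_quotient_submoduleOf {N P : Submodule R M} (h : N ≤ P) :
    Module.length R N + Module.length R (P ⧸ N.submoduleOf P) = Module.length R P := by
  rw [← (submoduleOfEquivOfLe h).length_eq]
  exact (Module.length_eq_add_of_exact (N.submoduleOf P).subtype (N.submoduleOf P).mkQ
    (subtype_injective _) (mkQ_surjective _) (LinearMap.exact_subtype_mkQ _)).symm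

lemma length_sup_add_length_inf (N P : Submodule R M) :
    Module.length R ↥(N ⊔ P) + Module.length R ↥(N ⊓ P) =
      Module.length R N + Module.length R P := by
  have e : Module.length R (N ⧸ (N ⊓ P).submoduleOf N) =
      Module.length R (↥(N ⊔ P) ⧸ P.submoduleOf (N ⊔ P)) := by
    have h := (LinearMap.quotientInfEquivSupQuotient N P).length_eq
    rwa [← submoduleOf, ← submoduleOf] at h
  rw [← length_add_length_quotient_submoduleOf (le_sup_right : P ≤ N ⊔ P),
    ← length_add_length_quotient_submoduleOf (inf_le_left : N ⊓ P ≤ N), e]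
  ring

lemma length_mono {N P : Submodule R M} (h : N ≤ P) : Module.length R N ≤ Module.length R P :=
  Module.length_le_of_injective (inclusion h) (inclusion_injective h)

end Submodule

section IdealLength

variable {A : Type*} [CommRing A] [IsArtinianRing A] {m : Ideal A}

lemma length_add_resQuotDim (hm : m.IsMaximal) {a b : Ideal A} (hba : b ≤ a) (hab : m * a ≤ b) :
    Module.length A b + resQuotDim m a b = Module.length A a := by
  set Q := Submodule.restrictScalars A (a.map (Ideal.Quotient.mk b)) with hQ
  have mem_Q {x : A} (hx : x ∈ a) : Ideal.Quotient.mk b x ∈ Q := Ideal.mem_map_of_mem _ hx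
  have tors : Module.IsTorsionBySet A Q (m : Set A) := by
    rintro ⟨y, hy⟩ ⟨r, hr⟩
    obtain ⟨x, hx, rfl⟩ :=
      (Ideal.mem_map_iff_of_surjective _ Ideal.Quotient.mk_surjective).mp hy
    exact Subtype.ext (Ideal.Quotient.eq_zero_iff_mem.mpr (hab (Ideal.mul_mem_mul hr hx)))
  have length_Q : Module.length A Q = resQuotDim m a b := by
    rw [resQuotDim, dif_pos tors]
    let := tors.module
    let : Field (A ⧸ m) := Ideal.Quotient.field m
    have : IsScalarTower A (A ⧸ m) Q := tors.isScalarTower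
    have : Module.Finite (A ⧸ m) Q := Module.Finite.of_restrictScalars_finite A _ _
    rw [Module.length_eq_of_surjective (R := A ⧸ m) Ideal.Quotient.mk_surjective]
    exact Module.length_eq_finrank (A ⧸ m) Q
  let g : a →ₗ[A] Q :=
    ((Ideal.Quotient.mkₐ A b).toLinearMap.comp a.subtype).codRestrict Q fun x ↦ mem_Q x.2
  rw [← length_Q]
  refine (Module.length_eq_add_of_exact (Submodule.inclusion hba) g
    (Submodule.inclusion_injective hba) ?_ ?_).symm
  · rintro ⟨y, hy⟩
    obtain ⟨x, hx, rfl⟩ :=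
      (Ideal.mem_map_iff_of_surjective _ Ideal.Quotient.mk_surjective).mp hy
    exact ⟨⟨x, hx⟩, rfl⟩
  · rintro ⟨x, hx⟩
    refine ⟨fun h ↦ ⟨⟨x, Ideal.Quotient.eq_zero_iff_mem.mp (congrArg Subtype.val h)⟩, rfl⟩, ?_⟩
    rintro ⟨y, hy⟩
    obtain rfl : (y : A) = x := congrArg Subtype.val hy
    exact Subtype.ext (Ideal.Quotient.eq_zero_iff_mem.mpr y.2)

lemma Ideal.le_colon_coe {A : Type*} [CommRing A] (m a : Ideal A) :
    a ≤ a.colon (m : Set A) :=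
  fun _ hx ↦ Submodule.mem_colon.mpr fun s _ ↦ a.mul_mem_right s hx

lemma Ideal.mul_colon_coe_le {A : Type*} [CommRing A] (m a : Ideal A) :
    m * a.colon (m : Set A) ≤ a :=
  Ideal.mul_le.mpr fun r hr s hs ↦ mul_comm s r ▸ Submodule.mem_colon.mp hs r hr

lemma length_add_tauL (hm : m.IsMaximal) (a : Ideal A) :
    Module.length A a + tauL m a = Module.length A (a.colon (m : Set A)) :=
  length_add_resQuotDim hm (Ideal.le_colon_coe m a) (Ideal.mul_colon_coe_le m a)

lemma length_mul_add_muL (hm : m.IsMaximal) (a : Ideal A) :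
    Module.length A ↥(m * a) + muL m a = Module.length A a :=
  length_add_resQuotDim hm Ideal.mul_le_right le_rfl

lemma tauL_le_muL_colon (hm : m.IsMaximal) (a : Ideal A) :
    tauL m a ≤ muL m (a.colon (m : Set A)) := by
  have h := (length_add_tauL hm a).trans (length_mul_add_muL hm (a.colon (m : Set A))).symm
  have hle := Submodule.length_mono (Ideal.mul_colon_coe_le m a)
  have h₁ := ENat.natCast_toNat (Module.length_ne_top (R := A) (M := a))
  have h₂ := ENat.natCast_toNat (Module.length_ne_top (R := A) (M := ↥(m * a.colon (m : Set A))))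
  rw [← h₁, ← h₂] at h hle
  norm_cast at h hle
  omega

lemma tauL_add_tauL_le (hm : m.IsMaximal) (a b : Ideal A) :
    tauL m a + tauL m b ≤ tauL m (a ⊔ b) + tauL m (a ⊓ b) := by
  have colon_inf : (a ⊓ b).colon (m : Set A) = a.colon (m : Set A) ⊓ b.colon (m : Set A) := by
    ext x
    simp only [Submodule.mem_colon, Submodule.mem_inf]
    exact forall₂_and
  have sup_colon_le :
      a.colon (m : Set A) ⊔ b.colon (m : Set A) ≤ (a ⊔ b).colon (m : Set A) :=
    sup_le (Submodule.colon_mono le_sup_left le_rfl) (Submodule.colon_mono le_sup_right le_rfl)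
  have hcolon := Submodule.length_sup_add_length_inf (a.colon (m : Set A)) (b.colon (m : Set A))
  have hle := Submodule.length_mono sup_colon_le
  rw [← colon_inf, ← length_add_tauL hm, ← length_add_tauL hm, ← length_add_tauL hm] at hcolon
  rw [← length_add_tauL hm] at hle
  have hideal := Submodule.length_sup_add_length_inf a b
  have natCast_toNat (I : Ideal A) := ENat.natCast_toNat (Module.length_ne_top (R := A) (M := I))
  rw [← natCast_toNat a, ← natCast_toNat b, ← natCast_toNat (a ⊓ b),
    ← natCast_toNat (a.colon (m : Set A) ⊔ b.colon (m : Set A))] at hcolon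
  rw [← natCast_toNat (a ⊔ b), ← natCast_toNat (a.colon (m : Set A) ⊔ b.colon (m : Set A))] at hle
  rw [← natCast_toNat a, ← natCast_toNat b, ← natCast_toNat (a ⊓ b), ← natCast_toNat (a ⊔ b)] at hideal
  norm_cast at hcolon hle hideal
  omega

end IdealLength

/-- **(Ikeda–Watanabe.)**  Let `(A, m)` be an Artinian Gorenstein local ring (i.e.
`dim_{A/m} (0 :_A m) = 1`) with Dilworth number `d(A) = max{μ(a)}`.  If `τ(a) = τ(b) = d(A)`
then `τ(a + b) = d(A)` and `τ(a ∩ b) = d(A)`: the family `G(A) = {a : τ(a) = d(A)}` is a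
lattice under sum and intersection. -/
theorem tau_sup_and_inf_of_tau_eq_dilworth
    {A : Type*} [CommRing A] [IsArtinianRing A] [IsLocalRing A]
    (m : Ideal A) (hm : m = IsLocalRing.maximalIdeal A)
    (hGor : tauL m (⊥ : Ideal A) = 1)
    (d : ℕ) (hd : IsGreatest {e : ℕ | ∃ a : Ideal A, muL m a = e} d)
    (a b : Ideal A) (ha : tauL m a = d) (hb : tauL m b = d) :
    tauL m (a + b) = d ∧ tauL m (a ⊓ b) = d := by
  have hmax : m.IsMaximal := hm ▸ IsLocalRing.maximalIdeal.isMaximal A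
  have tau_le (I : Ideal A) : tauL m I ≤ d :=
    (tauL_le_muL_colon hmax I).trans (hd.2 ⟨_, rfl⟩)
  have hadd := tauL_add_tauL_le hmax a b
  have hsup := tau_le (a ⊔ b)
  have hinf := tau_le (a ⊓ b)
  rw [Submodule.add_eq_sup]
  omega
end

section
/- Let (A, m) be an Artinian Gorenstein local ring with Dilworth number d(A). If a is an ideal of A with μ(a) = d(A), then (m a) :_A m = a; and if b is an ideal of A with τ(b) = d(A), then m (b :_A m) = b. Thus a ↦ m a and b ↦ b :_A m are mutually inverse bijections between F(A) = {a : μ(a) = d(A)} and G(A) = {b : τ(b) = d(A)}. -/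
theorem restrictScalars_map_mk_eq_map_mkQ {A : Type*} [CommRing A] (a b : Ideal A) :
    Submodule.restrictScalars A (a.map (Ideal.Quotient.mk b)) = Submodule.map b.mkQ a := by
  ext x
  rw [Submodule.restrictScalars_mem,
    Ideal.mem_map_iff_of_surjective _ Ideal.Quotient.mk_surjective]
  rfl

/-- Additivity of length along `0 → b → a → a/b → 0`. -/
theorem length_eq_length_add_length_map_mk {A : Type*} [CommRing A] {a b : Ideal A}
    (hba : b ≤ a) :
    Module.length A a = Module.length A b +
      Module.length A ↥(Submodule.restrictScalars A (a.map (Ideal.Quotient.mk b))) := by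
  rw [restrictScalars_map_mk_eq_map_mkQ]
  refine Module.length_eq_add_of_exact (Submodule.inclusion hba) (b.mkQ.submoduleMap a)
    (Submodule.inclusion_injective hba) (b.mkQ.submoduleMap_surjective a) fun x ↦ ?_
  rw [Subtype.ext_iff, LinearMap.submoduleMap_coe_apply]
  simp [Submodule.inclusion, Subtype.ext_iff, Ideal.Quotient.eq_zero_iff_mem]

theorem isTorsionBySet_map_mk {A : Type*} [CommRing A] {m a b : Ideal A} (h : m * a ≤ b) :
    Module.IsTorsionBySet A
      ↥(Submodule.restrictScalars A (a.map (Ideal.Quotient.mk b))) (m : Set A) := by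
  rw [restrictScalars_map_mk_eq_map_mkQ]
  rintro ⟨_, x, hx, rfl⟩ ⟨r, hr⟩
  apply Subtype.ext
  change b.mkQ (r * x) = 0
  exact (Submodule.Quotient.mk_eq_zero b).2 (h (Ideal.mul_mem_mul hr hx))

theorem length_map_mk_eq_resQuotDim {A : Type*} [CommRing A] [IsArtinianRing A]
    {m a b : Ideal A} (hm : m.IsMaximal) (h : m * a ≤ b) :
    Module.length A ↥(Submodule.restrictScalars A (a.map (Ideal.Quotient.mk b))) =
      resQuotDim m a b := by
  have ht := isTorsionBySet_map_mk h
  rw [resQuotDim, dif_pos ht]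
  let := ht.module
  let : Field (A ⧸ m) := Ideal.Quotient.field m
  have : IsScalarTower A (A ⧸ m)
      ↥(Submodule.restrictScalars A (a.map (Ideal.Quotient.mk b))) := ht.isScalarTower
  have : Module.Finite A ↥(Submodule.restrictScalars A (a.map (Ideal.Quotient.mk b))) := by
    rw [restrictScalars_map_mk_eq_map_mkQ]
    infer_instance
  have : Module.Finite (A ⧸ m)
      ↥(Submodule.restrictScalars A (a.map (Ideal.Quotient.mk b))) :=
    Module.Finite.of_restrictScalars_finite A _ _
  rw [Module.length_eq_of_surjective (R := A ⧸ m) (S := A) Ideal.Quotient.mk_surjective]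
  exact Module.length_eq_finrank _ _

theorem length_eq_length_add_resQuotDim {A : Type*} [CommRing A] [IsArtinianRing A]
    {m a b : Ideal A} (hm : m.IsMaximal) (hba : b ≤ a) (h : m * a ≤ b) :
    Module.length A a = Module.length A b + resQuotDim m a b := by
  rw [length_eq_length_add_length_map_mk hba, length_map_mk_eq_resQuotDim hm h]

theorem eq_of_le_of_length_le {A : Type*} [CommRing A] [IsArtinianRing A] {a b : Ideal A}
    (hab : a ≤ b) (h : Module.length A b ≤ Module.length A a) : a = b := by
  by_contra hne
  rw [Module.length_submodule, Module.length_submodule] at h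
  exact h.not_gt (Submodule.height_strictMono (lt_of_le_of_ne hab hne))

theorem le_colon_iff_mul_le {A : Type*} [CommRing A] {m a b : Ideal A} :
    a ≤ b.colon (m : Set A) ↔ m * a ≤ b := by
  rw [mul_comm, Ideal.mul_le]
  exact forall₂_congr fun _ _ ↦ Submodule.mem_colon

/-- **(Ikeda–Watanabe.)**  Let `(A, m)` be an Artinian Gorenstein local ring (i.e.
`dim_{A/m} (0 :_A m) = 1`) with Dilworth number `d(A) = max{μ(a)}`.  If `μ(a) = d(A)` then
`(m a) :_A m = a`, and if `τ(b) = d(A)` then `m (b :_A m) = b`; thus `a ↦ m a` and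
`b ↦ b :_A m` are mutually inverse bijections between `F(A) = {a : μ(a) = d(A)}` and
`G(A) = {b : τ(b) = d(A)}`. -/
theorem mul_colon_inverse_bijections_dilworth
    {A : Type*} [CommRing A] [IsArtinianRing A] [IsLocalRing A]
    (m : Ideal A) (hm : m = IsLocalRing.maximalIdeal A)
    (hGor : tauL m (⊥ : Ideal A) = 1)
    (d : ℕ) (hd : IsGreatest {e : ℕ | ∃ a : Ideal A, muL m a = e} d) :
    (∀ a : Ideal A, muL m a = d → (m * a).colon m = a) ∧
    (∀ b : Ideal A, tauL m b = d → m * (b.colon m) = b) := by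
  have hmax : m.IsMaximal := hm ▸ IsLocalRing.maximalIdeal.isMaximal A
  have hle (a : Ideal A) : muL m a ≤ d := hd.2 ⟨a, rfl⟩
  have hmu (a : Ideal A) : Module.length A a = Module.length A ↥(m * a) + muL m a :=
    length_eq_length_add_resQuotDim hmax Ideal.mul_le_right le_rfl
  refine ⟨fun a ha ↦ ?_, fun b hb ↦ ?_⟩
  · have hac : a ≤ (m * a).colon (m : Set A) := le_colon_iff_mul_le.2 le_rfl
    have hmc : m * (m * a).colon (m : Set A) = m * a :=
      (le_colon_iff_mul_le.1 le_rfl).antisymm (Ideal.mul_mono_right hac)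
    refine (eq_of_le_of_length_le hac ?_).symm
    rw [hmu, hmc, hmu a, ha]
    gcongr
    exact hle _
  · have hmb : m * b.colon (m : Set A) ≤ b := le_colon_iff_mul_le.1 le_rfl
    refine eq_of_le_of_length_le hmb ?_
    have htau : Module.length A ↥(b.colon (m : Set A)) = Module.length A b + tauL m b :=
      length_eq_length_add_resQuotDim hmax (le_colon_iff_mul_le.2 Ideal.mul_le_right) hmb
    rw [hmu, hb] at htau
    refine (ENat.add_le_add_iff_right (ENat.natCast_ne_top d)).1 ?_
    rw [← htau]
    gcongr
    exact hle _
end
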